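/- Let n ≥ 1 and let C₁, …, C_m be closed subsets of ℝⁿ whose union is all of ℝⁿ, such that each Cᵢ is homeomorphic to the orthant [0,∞)ⁿ, and such that for all i ≠ j the intersection Cᵢ ∩ C_j is either empty or homeomorphic to [0,∞)^{t(i,j)} for some natural number t(i,j) ≤ n − 1. Then for every pair of indices j, k ∈ {1, …, m} there exists a finite sequence of indices j = j₀, j₁, …, j_l = k such that for each 0 ≤ i < l the intersection C_{j_i} ∩ C_{j_{i+1}} is homeomorphic to [0,∞)^{n−1}. -/

import Mathlib

/-- The orthant `[0,∞)^t`, as a subset of `ℝ^t`. -/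
def orthant (t : ℕ) : Set (Fin t → ℝ) := {x | ∀ i, 0 ≤ x i}

open MeasureTheory Metric Set
open scoped NNReal ENNReal Topology

theorem exists_polynomial_eval_eq_det_one_add_smul {E : Type*} [NormedAddCommGroup E]
    [NormedSpace ℝ E] [FiniteDimensional ℝ E] (A : E →L[ℝ] E) :
    ∃ p : Polynomial ℝ, p.natDegree ≤ Module.finrank ℝ E ∧
      ∀ t : ℝ, p.eval t = (1 + t • A).det := by
  classical
  let b := Module.finBasis ℝ E
  let M := LinearMap.toMatrix b b (A : E →ₗ[ℝ] E)
  refine ⟨((Polynomial.X : Polynomial ℝ) • M.map Polynomial.C +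
    (1 : Matrix _ _ ℝ).map Polynomial.C).det, ?_, fun t => ?_⟩
  · simpa using Polynomial.natDegree_det_X_add_C_le M 1
  · rw [← Polynomial.coe_evalRingHom, RingHom.map_det, ContinuousLinearMap.det,
      ← LinearMap.det_toMatrix b]
    congr 1
    ext i j
    simp [M, LinearMap.toMatrix_apply, Matrix.one_apply, Finsupp.single_apply, eq_comm]
    split_ifs <;> simp [add_comm, mul_comm]

theorem exists_forall_norm_lt_det_one_add_pos {E : Type*} [NormedAddCommGroup E]
    [NormedSpace ℝ E] [FiniteDimensional ℝ E] :
    ∃ δ > 0, ∀ A : E →L[ℝ] E, ‖A‖ < δ → 0 < (1 + A).det := by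
  have hc : Continuous fun A : E →L[ℝ] E => (1 + A).det :=
    ContinuousLinearMap.continuous_det.comp (by fun_prop)
  have h1 : (1 + (0 : E →L[ℝ] E)).det = 1 := by simp [ContinuousLinearMap.det]
  have h : ∀ᶠ A in 𝓝 (0 : E →L[ℝ] E), 0 < (1 + A).det :=
    (hc.tendsto 0).eventually (lt_mem_nhds (by rw [h1]; exact one_pos))
  obtain ⟨δ, hδ, hb⟩ := Metric.eventually_nhds_iff.1 h
  exact ⟨δ, hδ, fun A hA => hb (by simpa using hA)⟩

theorem LipschitzWith.addHaar_image_eq_zero {E : Type*} [NormedAddCommGroup E]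
    [NormedSpace ℝ E] [FiniteDimensional ℝ E] [MeasurableSpace E] [BorelSpace E]
    (μ : Measure E) [μ.IsAddHaarMeasure] {f : E → E} {K : ℝ≥0} (hf : LipschitzWith K f)
    {s : Set E} (hs : μ s = 0) : μ (f '' s) = 0 := by
  let ν : Measure E := Measure.hausdorffMeasure (Module.finrank ℝ E)
  have hν : ν s = 0 := Measure.absolutelyContinuous_isAddHaarMeasure ν μ hs
  refine Measure.absolutelyContinuous_isAddHaarMeasure μ ν ?_
  refine le_antisymm ((hf.hausdorffMeasure_image_le (Nat.cast_nonneg _) s).trans ?_) bot_le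
  change _ * ν s ≤ 0
  simp [hν]

theorem image_ball_id_add_smul {E : Type*} [NormedAddCommGroup E]
    [NormedSpace ℝ E] [FiniteDimensional ℝ E] {u : E → E} {K : ℝ≥0} (hu : LipschitzWith K u)
    {R : ℝ} (hR : ∀ x, R ≤ ‖x‖ → u x = 0) {t : ℝ} (ht : |t| * K < 1) :
    Function.Injective (fun x => x + t • u x) ∧
      (fun x => x + t • u x) '' ball 0 R = ball 0 R := by
  have happ : ApproximatesLinearOn (fun x => x + t • u x)
      ((ContinuousLinearEquiv.refl ℝ E : E ≃L[ℝ] E) : E →L[ℝ] E) univ (‖t‖₊ * K) := by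
    rw [ApproximatesLinearOn.approximatesLinearOn_iff_lipschitzOnWith, lipschitzOnWith_univ]
    refine LipschitzWith.of_dist_le_mul fun x y => ?_
    have := hu.dist_le_mul x y
    simp only [dist_eq_norm] at this ⊢
    have e : ((fun x => x + t • u x) - ((ContinuousLinearEquiv.refl ℝ E : E ≃L[ℝ] E) : E →L[ℝ] E)) x
      - ((fun x => x + t • u x) - ((ContinuousLinearEquiv.refl ℝ E : E ≃L[ℝ] E) : E →L[ℝ] E)) y
      = t • (u x - u y) := by
        simp [smul_sub]
    rw [e, norm_smul]
    push_cast
    rw [mul_assoc]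
    exact mul_le_mul_of_nonneg_left this (norm_nonneg _)
  have hc : Subsingleton E ∨ ‖t‖₊ * K <
      ‖((ContinuousLinearEquiv.refl ℝ E).symm : E →L[ℝ] E)‖₊⁻¹ := by
    rcases subsingleton_or_nontrivial E with h | h
    · exact Or.inl h
    · right
      have : ‖((ContinuousLinearEquiv.refl ℝ E).symm : E →L[ℝ] E)‖₊ = 1 := by
        ext
        exact ContinuousLinearMap.norm_id
      rw [this, inv_one, ← NNReal.coe_lt_coe]
      simpa using ht
  have hinj : Function.Injective (fun x => x + t • u x) :=
    injOn_univ.1 (happ.injOn hc)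
  have hsurj : Function.Surjective (fun x => x + t • u x) := happ.surjective hc
  refine ⟨hinj, ?_⟩
  have hcompl : (fun x => x + t • u x) '' (ball 0 R)ᶜ = (ball 0 R)ᶜ := by
    have : EqOn (fun x => x + t • u x) id (ball 0 R)ᶜ := fun x hx => by
      simp [hR x (by simpa using hx)]
    rw [this.image_eq, image_id]
  rw [← compl_inj_iff, ← hcompl, ← image_compl_eq ⟨hinj, hsurj⟩]

/-- A Lipschitz map of the form `id + u`, with `u` supported in a ball, cannot have vanishing
Jacobian throughout that ball. The volume `∫ det (1 + t • u')` is polynomial in `t`, and equals the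
volume of the ball for small `t > 0`, hence also for `t = 1`. -/
theorem not_forall_det_one_add_fderiv_eq_zero {E : Type*} [NormedAddCommGroup E]
    [NormedSpace ℝ E] [FiniteDimensional ℝ E] {u : E → E} {K : ℝ≥0} (hu : LipschitzWith K u)
    {R : ℝ} (hR0 : 0 < R) (hR : ∀ x, R ≤ ‖x‖ → u x = 0) :
    ¬ ∀ x ∈ ball (0 : E) R, DifferentiableAt ℝ u x → (1 + fderiv ℝ u x).det = 0 := by
  borelize E
  intro hdet
  let μ : Measure E := Measure.addHaar
  let s : Set E := ball 0 R ∩ {x | DifferentiableAt ℝ u x}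
  have hs : MeasurableSet s := measurableSet_ball.inter (measurableSet_of_differentiableAt ℝ u)
  have hnull : μ (ball 0 R \ s) = 0 := by
    refine measure_mono_null ?_ (ae_iff.1 (hu.ae_differentiableAt (μ := μ)))
    intro x hx hx'
    exact hx.2 ⟨hx.1, hx'⟩
  obtain ⟨δ, hδ, hpos⟩ := exists_forall_norm_lt_det_one_add_pos (E := E)
  obtain ⟨τ, hτ, hτK⟩ : ∃ τ > 0, τ * (K : ℝ) < min δ 1 := by
    refine ⟨min δ 1 / (K + 1), by positivity, ?_⟩
    rw [div_mul_eq_mul_div, div_lt_iff₀ (by positivity)]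
    have : 0 < min δ 1 := by positivity
    nlinarith [K.coe_nonneg]
  have key : ∀ t, 0 < t → t ≤ τ →
      Integrable (fun x => (1 + t • fderiv ℝ u x).det) (μ.restrict s) ∧
      ∫ x in s, (1 + t • fderiv ℝ u x).det ∂μ = μ.real (ball 0 R) := by
    intro t ht htτ
    have htK : t * K < min δ 1 :=
      (mul_le_mul_of_nonneg_right htτ K.coe_nonneg).trans_lt hτK
    obtain ⟨hinj, himg⟩ := image_ball_id_add_smul hu hR (t := t)
      (by rw [abs_of_pos ht]; exact htK.trans_le (min_le_right _ _))
    have hpos' : ∀ x, 0 < (1 + t • fderiv ℝ u x).det := fun x => by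
      refine hpos _ ?_
      rw [norm_smul, Real.norm_of_nonneg ht.le]
      exact ((mul_le_mul_of_nonneg_left (norm_fderiv_le_of_lipschitz ℝ hu) ht.le).trans_lt
        htK).trans_le (min_le_left _ _)
    have hlip : LipschitzWith (1 + ‖t‖₊ * K) (fun x => x + t • u x) :=
      LipschitzWith.id.add ((lipschitzWith_smul t).comp hu)
    have hvol : μ ((fun x => x + t • u x) '' s) = μ (ball 0 R) := by
      refine le_antisymm (measure_mono ?_) ?_
      · exact (image_mono inter_subset_left).trans himg.subset
      · have : ball 0 R ⊆ (fun x => x + t • u x) '' s ∪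
            (fun x => x + t • u x) '' (ball 0 R \ s) := by
          rw [← image_union, union_sdiff_cancel inter_subset_left, himg]
        refine (measure_mono this).trans ((measure_union_le _ _).trans ?_)
        rw [hlip.addHaar_image_eq_zero μ hnull, add_zero]
    have hder : ∀ x ∈ s, HasFDerivWithinAt (fun x => x + t • u x)
        (1 + t • fderiv ℝ u x) s x := fun x hx =>
      ((hasFDerivAt_id x).add (hx.2.hasFDerivAt.const_smul t)).hasFDerivWithinAt
    have hlint := lintegral_abs_det_fderiv_eq_addHaar_image μ hs hder hinj.injOn
    rw [hvol] at hlint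
    simp_rw [abs_of_pos (hpos' _)] at hlint
    have hmeas : Measurable fun x => (1 + t • fderiv ℝ u x).det :=
      ContinuousLinearMap.continuous_det.measurable.comp
        (((measurable_fderiv ℝ u).const_smul t).const_add 1)
    constructor
    · refine ⟨hmeas.aestronglyMeasurable, ?_⟩
      rw [hasFiniteIntegral_iff_ofReal (Filter.Eventually.of_forall fun x => (hpos' x).le), hlint]
      exact measure_ball_lt_top
    · rw [integral_eq_lintegral_of_nonneg_ae (Filter.Eventually.of_forall fun x => (hpos' x).le)
        hmeas.aestronglyMeasurable, hlint]
      rfl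
  let N := Finset.range (Module.finrank ℝ E + 1)
  let v : ℕ → ℝ := fun j => τ / (j + 1)
  have hv0 : ∀ j, 0 < v j := fun j => by positivity
  have hvτ : ∀ j, v j ≤ τ := fun j => div_le_self hτ.le (by linarith [j.cast_nonneg (α := ℝ)])
  have hinj : Set.InjOn v N := by
    intro i _ j _ h
    have h' : τ / ((i : ℝ) + 1) = τ / (j + 1) := h
    field_simp at h'
    exact_mod_cast (add_right_cancel h').symm
  let w : ℕ → ℝ := fun j => (Lagrange.basis N v j).eval 1
  have hw : ∑ j ∈ N, w j = 1 := by
    have := congrArg (Polynomial.eval 1) (Lagrange.sum_basis hinj ⟨0, by simp [N]⟩)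
    simpa [w, Polynomial.eval_finsetSum] using this
  have hzero : ∀ x ∈ s, ∑ j ∈ N, w j * (1 + v j • fderiv ℝ u x).det = 0 := by
    intro x hx
    obtain ⟨p, hp, hpe⟩ := exists_polynomial_eval_eq_det_one_add_smul (fderiv ℝ u x)
    have hdeg : p.degree < N.card := by
      refine Polynomial.degree_le_natDegree.trans_lt ?_
      simp only [N, Finset.card_range]
      exact_mod_cast Nat.lt_succ_of_le hp
    have := congrArg (Polynomial.eval 1) (Lagrange.eq_interpolate hinj hdeg)
    rw [hpe 1, one_smul, hdet x hx.1 hx.2, Lagrange.interpolate_apply,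
      Polynomial.eval_finsetSum] at this
    rw [this]
    refine Finset.sum_congr rfl fun j _ => ?_
    simp [w, hpe, mul_comm]
  have hint : ∫ x in s, ∑ j ∈ N, w j * (1 + v j • fderiv ℝ u x).det ∂μ = μ.real (ball 0 R) := by
    rw [integral_finsetSum _ fun j _ => (key _ (hv0 j) (hvτ j)).1.const_mul _]
    simp_rw [integral_const_mul, (key _ (hv0 _) (hvτ _)).2]
    rw [← Finset.sum_mul, hw, one_mul]
  rw [setIntegral_congr_fun hs hzero, integral_zero] at hint
  exact (ENNReal.toReal_pos (measure_ball_pos μ 0 hR0).ne' measure_ball_lt_top.ne).ne hint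

theorem LipschitzOnWith.lipschitzWith_of_eq_zero {E F : Type*} [NormedAddCommGroup E]
    [NormedSpace ℝ E] [NormedAddCommGroup F] {u : E → F} {K : ℝ≥0} {R : ℝ}
    (hu : LipschitzOnWith K u (closedBall 0 R)) (hR : ∀ x, R ≤ ‖x‖ → u x = 0) :
    LipschitzWith K u := by
  have aux : ∀ x y, ‖x‖ ≤ R → R ≤ ‖y‖ → dist (u x) (u y) ≤ K * dist x y := by
    intro x y hx hy
    have hc : ContinuousOn (fun t : ℝ => ‖AffineMap.lineMap x y t‖) (Icc 0 1) :=
      (continuous_norm.comp AffineMap.lineMap_continuous).continuousOn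
    obtain ⟨t, ht, htR⟩ := intermediate_value_Icc zero_le_one hc
      (show R ∈ Icc _ _ by simpa using ⟨hx, hy⟩)
    have htR' : ‖AffineMap.lineMap x y t‖ = R := htR
    have h := hu.dist_le_mul x (by simpa using hx) (AffineMap.lineMap x y t)
      (by simpa using htR'.le)
    rw [hR _ htR'.ge, dist_left_lineMap, Real.norm_of_nonneg ht.1] at h
    rw [hR y hy]
    refine h.trans (mul_le_mul_of_nonneg_left ?_ K.coe_nonneg)
    exact mul_le_of_le_one_left dist_nonneg ht.2
  refine LipschitzWith.of_dist_le_mul fun x y => ?_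
  rcases le_total ‖x‖ R with hx | hx <;> rcases le_total ‖y‖ R with hy | hy
  · exact hu.dist_le_mul x (by simpa using hx) y (by simpa using hy)
  · exact aux x y hx hy
  · rw [dist_comm, dist_comm x]
    exact aux y x hy hx
  · rw [hR x hx, hR y hy, dist_self]
    positivity

/-- No-retraction principle: a `C¹` map equal to the identity outside a ball has a zero. -/
theorem ContDiff.exists_eq_zero_of_eq_id {E : Type*} [NormedAddCommGroup E]
    [InnerProductSpace ℝ E] [FiniteDimensional ℝ E] {F : E → E} (hF : ContDiff ℝ 1 F)
    {R : ℝ} (hR0 : 0 < R) (hR : ∀ x, R ≤ ‖x‖ → F x = x) : ∃ x, F x = 0 := by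
  classical
  by_contra! hne
  let G : E → E := fun x => (R * ‖F x‖⁻¹) • F x
  have hG : ContDiff ℝ 1 G :=
    (contDiff_const.mul ((hF.norm ℝ hne).inv fun x => norm_ne_zero_iff.2 (hne x))).smul hF
  have hGn : ∀ x, ‖G x‖ = R := fun x => by
    have := norm_ne_zero_iff.2 (hne x)
    simp only [G, norm_smul, norm_mul, norm_inv, norm_norm, Real.norm_of_nonneg hR0.le]
    field_simp
  let u : E → E := fun x => if ‖x‖ < R then G x - x else 0
  have huR : ∀ x, R ≤ ‖x‖ → u x = 0 := fun x hx => if_neg hx.not_gt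
  have huG : EqOn u (fun x => G x - x) (closedBall 0 R) := by
    intro x hx
    rcases (mem_closedBall_zero_iff.1 hx).lt_or_eq with h | h
    · exact if_pos h
    · rw [huR x h.ge]
      simp [G, hR x h.ge, h, hR0.ne']
  obtain ⟨K, hK⟩ := (hG.sub contDiff_id).locallyLipschitz.locallyLipschitzOn
    |>.exists_lipschitzOnWith_of_compact (isCompact_closedBall (0 : E) R)
  have hK' : LipschitzOnWith K u (closedBall 0 R) := fun x hx y hy => by
    rw [huG hx, huG hy]
    exact hK hx hy
  refine not_forall_det_one_add_fderiv_eq_zero (hK'.lipschitzWith_of_eq_zero huR) hR0 huR ?_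
  intro x hx _
  have hGd : HasFDerivAt G (fderiv ℝ G x) x := (hG.differentiable one_ne_zero x).hasFDerivAt
  have hud : HasFDerivAt u (fderiv ℝ G x - ContinuousLinearMap.id ℝ E) x := by
    refine (hGd.sub (hasFDerivAt_id x)).congr_of_eventuallyEq ?_
    filter_upwards [isOpen_ball.mem_nhds hx] with y hy using huG (ball_subset_closedBall hy)
  have h1 : 1 + fderiv ℝ u x = fderiv ℝ G x := by
    rw [hud.fderiv]
    exact add_sub_cancel _ _
  rw [h1]
  by_contra hdet
  obtain ⟨h, hh⟩ := ((fderiv ℝ G x).toContinuousLinearEquivOfDetNeZero hdet).surjective (G x)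
  have hh' : fderiv ℝ G x h = G x := hh
  have hsq := hGd.norm_sq
  have hconst : (fun y => ‖G y‖ ^ 2) = fun _ => R ^ 2 := by simp [hGn]
  rw [hconst] at hsq
  have := congrArg (fun L : E →L[ℝ] ℝ => L h) (hsq.unique (hasFDerivAt_const _ _))
  simp [hh', hGn, hR0.ne'] at this

theorem Continuous.exists_eq_zero_of_dist_id_le {E : Type*} [NormedAddCommGroup E]
    [InnerProductSpace ℝ E] [FiniteDimensional ℝ E] {F : E → E} (hF : Continuous F)
    {M : ℝ} (hM : ∀ x, ‖F x - x‖ ≤ M) : ∃ x, F x = 0 := by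
  by_contra! hne
  have hM0 : 0 ≤ M := (norm_nonneg _).trans (hM 0)
  let χ : E → ℝ := fun x => max 0 (min 1 (M + 2 - ‖x‖))
  have hχ0 : ∀ x, 0 ≤ χ x := fun x => le_max_left _ _
  have hχ1 : ∀ x, χ x ≤ 1 := fun x => max_le zero_le_one (min_le_left _ _)
  let u : E → E := fun x => χ x • (F x - x)
  have hu : Continuous u := by fun_prop
  have hu0 : ∀ x, M + 2 ≤ ‖x‖ → u x = 0 := fun x hx => by
    have : χ x = 0 := max_eq_left ((min_le_right _ _).trans (by linarith))
    simp [u, this]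
  have hpos : ∀ x, 0 < ‖x + u x‖ := fun x => by
    rw [norm_pos_iff]
    rcases le_or_gt ‖x‖ (M + 1) with hx | hx
    · have : χ x = 1 := by
        have h1 : min 1 (M + 2 - ‖x‖) = 1 := min_eq_left (by linarith)
        simp [χ, h1]
      simpa [u, this] using hne x
    · intro h
      have h1 : ‖u x‖ ≤ M := by
        rw [norm_smul, Real.norm_of_nonneg (hχ0 x)]
        exact (mul_le_of_le_one_left (norm_nonneg _) (hχ1 x)).trans (hM x)
      rw [eq_neg_of_add_eq_zero_right h, norm_neg] at h1
      linarith
  obtain ⟨v, hv, hvu, hsupp⟩ := hu.exists_contDiff_approx 1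
    (ε := fun x => ‖x + u x‖) (by fun_prop) hpos
  obtain ⟨x, hx⟩ := ContDiff.exists_eq_zero_of_eq_id (F := fun x => x + v x)
    (contDiff_id.add hv) (R := M + 2) (by linarith) fun x hx => by
      have : v x = 0 := by
        by_contra h
        exact hsupp h (hu0 x hx)
      simp [this]
  have := hvu x
  rw [eq_neg_of_add_eq_zero_right hx, dist_eq_norm, ← norm_neg] at this
  simp [add_comm] at this

/-- The Poincaré–Miranda theorem on the cube `[-1,1]ⁿ`. -/
theorem poincare_miranda {n : ℕ} {f : Icc (-1 : Fin n → ℝ) 1 → Fin n → ℝ}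
    (hf : Continuous f) (hneg : ∀ x i, x.1 i = -1 → f x i ≤ 0)
    (hpos : ∀ x i, x.1 i = 1 → 0 ≤ f x i) : ∃ x, f x = 0 := by
  let c : EuclideanSpace ℝ (Fin n) → Icc (-1 : Fin n → ℝ) 1 := fun y =>
    ⟨fun i => max (-1) (min 1 (y i)),
      fun i => le_max_left _ _, fun i => max_le (by simp) (min_le_left _ _)⟩
  have hc : Continuous c := by fun_prop
  let g : Icc (-1 : Fin n → ℝ) 1 → EuclideanSpace ℝ (Fin n) := fun x => WithLp.toLp 2 (f x - x.1)
  have hg : Continuous g := (PiLp.continuous_toLp 2 _).comp (by fun_prop)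
  obtain ⟨M, hM⟩ := isCompact_univ.exists_bound_of_continuousOn hg.continuousOn
  obtain ⟨y, hy⟩ := Continuous.exists_eq_zero_of_dist_id_le (F := fun y => y + g (c y))
    (by fun_prop) (M := M) fun y => by simpa using hM (c y) (mem_univ _)
  have hyi : ∀ i, y i + (f (c y) i - (c y).1 i) = 0 := fun i =>
    congrArg (fun z : EuclideanSpace ℝ (Fin n) => z i) hy
  refine ⟨c y, funext fun i => ?_⟩
  have h := hyi i
  have hci : (c y).1 i = max (-1) (min 1 (y i)) := rfl
  rcases lt_or_ge (y i) (-1) with h3 | h3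
  · have h1 : (c y).1 i = -1 := by
      rw [hci]
      exact max_eq_left ((min_le_right _ _).trans h3.le)
    linarith [hneg _ _ h1]
  · rcases lt_or_ge 1 (y i) with h4 | h4
    · have h1 : (c y).1 i = 1 := by
        rw [hci, min_eq_left h4.le]
        norm_num
      linarith [hpos _ _ h1]
    · rw [min_eq_right h4, max_eq_right h3] at hci
      rw [hci] at h
      simpa using h

/-- A set admitting a continuous injection into some `ℝᵗ` with `t < d`. -/
def InjectsBelow {X : Type*} [TopologicalSpace X] (d : ℕ) (Y : Set X) : Prop :=
  ∃ t < d, ∃ φ : Y → Fin t → ℝ, Continuous φ ∧ Function.Injective φ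

theorem InjectsBelow.preimage {X Z : Type*} [TopologicalSpace X] [TopologicalSpace Z] {d : ℕ}
    {Y : Set Z} (hY : InjectsBelow d Y) {T : X → Z} (hT : Continuous T)
    (hinj : Function.Injective T) : InjectsBelow d (T ⁻¹' Y) := by
  obtain ⟨t, ht, φ, hφ, hφi⟩ := hY
  refine ⟨t, ht, φ ∘ Y.restrictPreimage T, hφ.comp hT.restrictPreimage,
    hφi.comp (hinj.restrictPreimage Y)⟩

theorem InjectsBelow.mono {X : Type*} [TopologicalSpace X] {d e : ℕ} {Y : Set X}
    (hY : InjectsBelow d Y) (h : d ≤ e) : InjectsBelow e Y :=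
  let ⟨t, ht, hφ⟩ := hY
  ⟨t, ht.trans_le h, hφ⟩

theorem InjectsBelow.of_homeomorph_orthant {X : Type*} [TopologicalSpace X] {d t : ℕ} {Y : Set X}
    (e : Y ≃ₜ orthant t) (h : t < d) : InjectsBelow d Y :=
  ⟨t, h, fun y => (e y : Fin t → ℝ), continuous_subtype_val.comp e.continuous,
    Subtype.val_injective.comp e.injective⟩

/-- On a closed set injecting into dimension `< d`, a generic map to `ℝᵈ` avoids zero. -/
theorem InjectsBelow.isOpen_dense_forall_ne_zero {X : Type*} [TopologicalSpace X]
    [CompactSpace X] [T2Space X] {d : ℕ} {Y : Set X} (hY : InjectsBelow d Y) (hc : IsClosed Y) :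
    IsOpen {g : C(X, Fin d → ℝ) | ∀ x ∈ Y, g x ≠ 0} ∧
      Dense {g : C(X, Fin d → ℝ) | ∀ x ∈ Y, g x ≠ 0} := by
  refine ⟨ContinuousMap.isOpen_setOfPred_mapsTo hc.isCompact isOpen_compl_singleton, ?_⟩
  obtain ⟨t, ht, φ, hφ, hφi⟩ := hY
  have : CompactSpace Y := isCompact_iff_compactSpace.1 hc.isCompact
  obtain ⟨ψ, hψ⟩ := ContinuousMap.exists_restrict_eq hc (⟨φ, hφ⟩ : C(Y, Fin t → ℝ))
  have hψ' : ∀ y : Y, ψ y = φ y := fun y => congrArg (fun k : C(Y, Fin t → ℝ) => k y) hψ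
  refine Metric.dense_iff.2 fun g ε hε => ?_
  obtain ⟨h, hh⟩ := ContinuousMap.exists_extension (hφ.isClosedEmbedding hφi) (g.restrict Y)
  have hh' : ∀ y : Y, h (φ y) = g y := fun y => congrArg (fun k : C(Y, Fin d → ℝ) => k y) hh
  obtain ⟨p, hp, hph, -⟩ := h.continuous.exists_contDiff_approx 1
    (ε := fun _ => ε / 4) continuous_const fun _ => by positivity
  obtain ⟨v, hv, hvε⟩ := (hp.dense_compl_range_of_finrank_lt_finrank (by simpa using ht)
    : Dense (range p)ᶜ).exists_dist_lt 0 (show 0 < ε / 4 by positivity)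
  let q : C(X, Fin d → ℝ) :=
    ⟨fun x => g x + (p (ψ x) - h (ψ x)) - v, by have := hp.continuous; fun_prop⟩
  refine ⟨q, ?_, fun x hx h0 => hv ⟨ψ x, ?_⟩⟩
  · refine mem_ball.2 (lt_of_le_of_lt ((ContinuousMap.dist_le (by positivity : 0 ≤ ε / 2)).2
      fun x => ?_) (half_lt_self hε))
    have h1 := hph (ψ x)
    rw [dist_eq_norm] at h1 ⊢
    rw [dist_zero_left] at hvε
    have : q x - g x = (p (ψ x) - h (ψ x)) - v := by simp only [q, ContinuousMap.coe_mk]; abel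
    rw [this]
    linarith [norm_sub_le (p (ψ x) - h (ψ x)) v]
  · have h1 : h (ψ x) = g x := (congrArg h (hψ' ⟨x, hx⟩)).trans (hh' ⟨x, hx⟩)
    simpa [q, h1, sub_eq_zero] using h0

theorem exists_dist_lt_forall_ne_zero {X : Type*} [TopologicalSpace X]
    [CompactSpace X] [T2Space X] {d : ℕ} {ι : Type*} [Countable ι] {Y : ι → Set X}
    (hY : ∀ k, InjectsBelow d (Y k)) (hc : ∀ k, IsClosed (Y k)) (g₀ : C(X, Fin d → ℝ))
    {ε : ℝ} (hε : 0 < ε) :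
    ∃ g : C(X, Fin d → ℝ), (∀ x i, |g x i - g₀ x i| < ε) ∧ ∀ k, ∀ x ∈ Y k, g x ≠ 0 := by
  have hd := dense_iInter_of_isOpen (fun k => ((hY k).isOpen_dense_forall_ne_zero (hc k)).1)
    (fun k => ((hY k).isOpen_dense_forall_ne_zero (hc k)).2)
  obtain ⟨g, hg, hgε⟩ := hd.exists_dist_lt g₀ hε
  rw [dist_comm] at hgε
  exact ⟨g, fun x i => ((dist_le_pi_dist (g x) (g₀ x) i).trans
    (ContinuousMap.dist_apply_le_dist x)).trans_lt hgε, fun k => mem_iInter.1 hg k⟩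

theorem iUnion_ne_univ_of_injectsBelow {n : ℕ} {ι : Type*} [Countable ι]
    {Y : ι → Set (Icc (-1 : Fin n → ℝ) 1)}
    (hY : ∀ k, InjectsBelow n (Y k)) (hc : ∀ k, IsClosed (Y k)) : ⋃ k, Y k ≠ univ := by
  intro hU
  obtain ⟨g, hg, hg0⟩ := exists_dist_lt_forall_ne_zero hY hc
    ⟨Subtype.val, continuous_subtype_val⟩ one_pos
  have hgi : ∀ x i, |g x i - x.1 i| < 1 := hg
  obtain ⟨x, h0⟩ := poincare_miranda g.continuous
    (fun x i hx => by linarith [(abs_lt.1 (hgi x i)).2])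
    (fun x i hx => by linarith [(abs_lt.1 (hgi x i)).1])
  obtain ⟨k, hk⟩ := mem_iUnion.1 (hU.ge (mem_univ x))
  exact hg0 k x hk h0

/-- Countably many closed sets that inject into dimension `< d` do not separate `ℝᵈ⁺¹`. -/
theorem subset_or_subset_of_inter_subset_iUnion {d : ℕ} {ι : Type*} [Countable ι]
    {P Q : Set (EuclideanSpace ℝ (Fin (d + 1)))} (hP : IsClosed P) (hQ : IsClosed Q)
    (hPQ : P ∪ Q = univ) {Y : ι → Set (EuclideanSpace ℝ (Fin (d + 1)))}
    (hY : ∀ k, InjectsBelow d (Y k)) (hc : ∀ k, IsClosed (Y k)) (hsub : P ∩ Q ⊆ ⋃ k, Y k) :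
    P ⊆ Q ∨ Q ⊆ P := by
  by_contra! h
  obtain ⟨⟨p, hpP, hpQ⟩, q, hqQ, hqP⟩ := h.imp not_subset.1 not_subset.1
  have hpq : p ≠ q := fun e => hpQ (e ▸ hqQ)
  obtain ⟨i₀, hi₀⟩ : ∃ i, p i ≠ q i := by
    by_contra! h
    exact hpq (PiLp.ext h)
  let T₀ : ℝ → (Fin (d + 1) → ℝ) → EuclideanSpace ℝ (Fin (d + 1)) := fun ε x =>
    WithLp.toLp 2 fun i => (1 - x i₀) / 2 * p i + (1 + x i₀) / 2 * q i +
      if i = i₀ then 0 else ε * x i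
  have hT₀ : Continuous T₀.uncurry := by
    refine (PiLp.continuous_toLp 2 _).comp (continuous_pi fun i => ?_)
    by_cases hi : i = i₀
    · simp only [hi, if_true]
      fun_prop
    · simp only [hi, if_false]
      fun_prop
  -- thin tubes around the segment from `p` to `q` have their ends off `Q` and off `P`
  obtain ⟨ε, hε, hεp, hεq⟩ : ∃ ε : ℝ, 0 < ε ∧
      (∀ x ∈ Icc (-1 : Fin (d + 1) → ℝ) 1, x i₀ = -1 → T₀ ε x ∉ Q) ∧
      (∀ x ∈ Icc (-1 : Fin (d + 1) → ℝ) 1, x i₀ = 1 → T₀ ε x ∉ P) := by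
    have key : ∀ (s : ℝ) (a : EuclideanSpace ℝ (Fin (d + 1))) (S : Set _), IsClosed S → a ∉ S →
        (∀ x : Fin (d + 1) → ℝ, x i₀ = s → T₀ 0 x = a) →
        ∀ᶠ ε in 𝓝 (0 : ℝ), ∀ x ∈ Icc (-1 : Fin (d + 1) → ℝ) 1, x i₀ = s → T₀ ε x ∉ S := by
      intro s a S hS ha h0
      have hK : IsCompact (Icc (-1 : Fin (d + 1) → ℝ) 1 ∩ {x | x i₀ = s}) :=
        isCompact_Icc.inter_right (isClosed_eq (continuous_apply i₀) continuous_const)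
      have := hK.eventually_forall_of_forall_eventually (x₀ := (0 : ℝ))
        (P := fun ε x => T₀ ε x ∉ S) fun x hx =>
          hT₀.continuousAt.eventually (hS.isOpen_compl.mem_nhds
            (by rw [Function.uncurry_apply_pair, h0 x hx.2]; exact ha))
      filter_upwards [this] with ε hε x hx hxs using hε x ⟨hx, hxs⟩
    have hp := key (-1) p Q hQ hpQ fun x hx => by
      ext i
      simp [T₀, hx]
    have hq := key 1 q P hP hqP fun x hx => by
      ext i
      simp [T₀, hx]
    obtain ⟨ε, hε, h⟩ := (((hp.and hq).filter_mono nhdsWithin_le_nhds).and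
      (self_mem_nhdsWithin : Ioi (0 : ℝ) ∈ 𝓝[>] 0)).exists
    exact ⟨ε, h, hε⟩
  let T : Icc (-1 : Fin (d + 1) → ℝ) 1 → EuclideanSpace ℝ (Fin (d + 1)) := fun x => T₀ ε x.1
  have hT : Continuous T := hT₀.comp (continuous_const.prodMk continuous_subtype_val)
  have hTinj : Function.Injective T := by
    intro x y hxy
    have hi : ∀ i, T x i = T y i := fun i => by rw [hxy]
    have h0 : x.1 i₀ = y.1 i₀ := by
      have h1 := hi i₀
      simp only [T, T₀, if_true] at h1
      refine mul_right_cancel₀ (sub_ne_zero.2 hi₀) ?_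
      linarith
    refine Subtype.ext (funext fun i => ?_)
    by_cases h : i = i₀
    · rw [h, h0]
    · have h1 := hi i
      simp only [T, T₀, h, h0, if_false] at h1
      exact mul_left_cancel₀ hε.ne' (add_left_cancel h1)
  obtain ⟨g, hg, hg0⟩ := exists_dist_lt_forall_ne_zero
    (fun k => (hY k).preimage hT hTinj) (fun k => (hc k).preimage hT)
    ⟨fun x j => x.1 (i₀.succAbove j),
      continuous_pi fun _ => (continuous_apply _).comp continuous_subtype_val⟩ one_pos
  have hgi : ∀ x j, |g x j - x.1 (i₀.succAbove j)| < 1 := hg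
  let f : Icc (-1 : Fin (d + 1) → ℝ) 1 → Fin (d + 1) → ℝ := fun x =>
    i₀.insertNth (infDist (T x) P - infDist (T x) Q) (g x)
  have hfc : Continuous f := by
    refine Continuous.finInsertNth i₀ ?_ g.continuous
    exact ((continuous_infDist_pt P).comp hT).sub ((continuous_infDist_pt Q).comp hT)
  have hf0 : ∀ x, f x i₀ = infDist (T x) P - infDist (T x) Q := fun x => Fin.insertNth_apply_same ..
  have hfs : ∀ x j, f x (i₀.succAbove j) = g x j := fun x j => Fin.insertNth_apply_succAbove ..
  have hmem : ∀ x, T x ∈ P ∨ T x ∈ Q := fun x => hPQ.ge (mem_univ (T x))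
  obtain ⟨x, hx⟩ := poincare_miranda hfc
    (fun x i hxi => by
      rcases Fin.eq_self_or_eq_succAbove i₀ i with rfl | ⟨j, rfl⟩
      · have := (hmem x).resolve_right (hεp x.1 x.2 hxi)
        rw [hf0, infDist_zero_of_mem this, zero_sub]
        exact neg_nonpos.2 infDist_nonneg
      · rw [hfs]
        linarith [(abs_lt.1 (hgi x j)).2])
    (fun x i hxi => by
      rcases Fin.eq_self_or_eq_succAbove i₀ i with rfl | ⟨j, rfl⟩
      · have := (hmem x).resolve_left (hεq x.1 x.2 hxi)
        rw [hf0, infDist_zero_of_mem this, sub_zero]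
        exact infDist_nonneg
      · rw [hfs]
        linarith [(abs_lt.1 (hgi x j)).1])
  have hdist : infDist (T x) P = infDist (T x) Q := by
    have := congrFun hx i₀
    rw [hf0] at this
    exact sub_eq_zero.1 this
  have hPQx : T x ∈ P ∩ Q := by
    rcases hmem x with h | h
    · refine ⟨h, (hQ.mem_iff_infDist_zero ⟨q, hqQ⟩).2 ?_⟩
      rw [← hdist, infDist_zero_of_mem h]
    · refine ⟨(hP.mem_iff_infDist_zero ⟨p, hpP⟩).2 ?_, h⟩
      rw [hdist, infDist_zero_of_mem h]
  obtain ⟨k, hk⟩ := mem_iUnion.1 (hsub hPQx)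
  exact hg0 k x hk (funext fun j => by rw [← hfs, hx, Pi.zero_apply, Pi.zero_apply])

theorem not_subset_iUnion_of_homeomorph_orthant {n : ℕ} {X : Type*} [TopologicalSpace X]
    {S : Set X} (e : S ≃ₜ orthant n) {ι : Type*} [Countable ι] {Y : ι → Set X}
    (hY : ∀ k, InjectsBelow n (Y k)) (hc : ∀ k, IsClosed (Y k)) : ¬ S ⊆ ⋃ k, Y k := by
  intro hS
  let c : Icc (-1 : Fin n → ℝ) 1 → orthant n := fun x =>
    ⟨x.1 + 1, fun i => neg_le_iff_add_nonneg.1 (x.2.1 i)⟩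
  have hcc : Continuous c := by fun_prop
  have hci : Function.Injective c := fun x y h =>
    Subtype.ext (add_right_cancel (congrArg Subtype.val h))
  let T : Icc (-1 : Fin n → ℝ) 1 → X := fun x => e.symm (c x)
  have hT : Continuous T := continuous_subtype_val.comp (e.symm.continuous.comp hcc)
  have hTi : Function.Injective T := Subtype.val_injective.comp (e.symm.injective.comp hci)
  refine iUnion_ne_univ_of_injectsBelow (fun k => (hY k).preimage hT hTi)
    (fun k => (hc k).preimage hT) ?_
  rw [← preimage_iUnion]
  exact eq_univ_of_forall fun x => hS (e.symm (c x)).2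

theorem Relation.ReflTransGen.exists_fin_chain {α : Type*} {r : α → α → Prop} {a b : α}
    (h : Relation.ReflTransGen r a b) : ∃ (l : ℕ) (s : Fin (l + 1) → α),
      s 0 = a ∧ s (Fin.last l) = b ∧ ∀ i : Fin l, r (s i.castSucc) (s i.succ) := by
  induction h with
  | refl => exact ⟨0, fun _ => a, rfl, rfl, fun i => i.elim0⟩
  | @tail b c _ hbc ih =>
    obtain ⟨l, s, h0, hl, hs⟩ := ih
    refine ⟨l + 1, Fin.snoc s c, ?_, Fin.snoc_last .., fun i => ?_⟩
    · rw [← Fin.castSucc_zero, Fin.snoc_castSucc, h0]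
    · refine Fin.lastCases ?_ (fun i => ?_) i
      · rw [Fin.snoc_castSucc, Fin.succ_last, Fin.snoc_last, hl]
        exact hbc
      · rw [Fin.snoc_castSucc, ← Fin.castSucc_succ, Fin.snoc_castSucc]
        exact hs i

/-- Orthant chain connectivity: if ℝⁿ is covered by finitely many closed sets
homeomorphic to n-orthants, whose pairwise intersections are empty or homeomorphic
to orthants of dimension ≤ n − 1, then any two of them are joined by a chain of
orthants with consecutive intersections homeomorphic to an (n−1)-orthant. -/
theorem orthant_chain_connectivity
    (n : ℕ) (hn : 1 ≤ n) (m : ℕ)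
    (C : Fin m → Set (EuclideanSpace ℝ (Fin n)))
    (hclosed : ∀ i, IsClosed (C i))
    (hcover : (⋃ i, C i) = Set.univ)
    (hhomeo : ∀ i, Nonempty (↥(C i) ≃ₜ ↥(orthant n)))
    (hpair : ∀ i j : Fin m, i ≠ j →
      (C i ∩ C j = ∅) ∨
      ∃ t : ℕ, t ≤ n - 1 ∧ Nonempty (↥(C i ∩ C j) ≃ₜ ↥(orthant t))) :
    ∀ j k : Fin m, ∃ (l : ℕ) (js : Fin (l + 1) → Fin m),
      js 0 = j ∧ js (Fin.last l) = k ∧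
      ∀ i : Fin l,
        Nonempty (↥(C (js i.castSucc) ∩ C (js i.succ)) ≃ₜ ↥(orthant (n - 1))) := by
  intro j k
  obtain ⟨d, rfl⟩ := Nat.exists_eq_add_of_le' hn
  let r : Fin m → Fin m → Prop := fun a b => Nonempty (↥(C a ∩ C b) ≃ₜ ↥(orthant d))
  suffices h : Relation.ReflTransGen r j k from h.exists_fin_chain
  by_contra hjk
  let A : Set (Fin m) := {i | Relation.ReflTransGen r j i}
  let ι := {ab : Fin m × Fin m // ab.1 ∈ A ∧ ab.2 ∉ A ∧ (C ab.1 ∩ C ab.2).Nonempty}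
  let Y : ι → Set (EuclideanSpace ℝ (Fin (d + 1))) := fun ab => C ab.1.1 ∩ C ab.1.2
  have hYc : ∀ ab, IsClosed (Y ab) := fun ab => (hclosed _).inter (hclosed _)
  have hY : ∀ ab, InjectsBelow d (Y ab) := by
    rintro ⟨⟨a, b⟩, ha, hb, hab⟩
    obtain ⟨t, ht, ⟨e⟩⟩ := (hpair a b fun h => hb (h ▸ ha)).resolve_left hab.ne_empty
    refine .of_homeomorph_orthant e (lt_of_le_of_ne ht ?_)
    rintro rfl
    exact hb (Relation.ReflTransGen.tail ha ⟨e⟩)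
  have hsub : (⋃ i ∈ A, C i) ∩ ⋃ i ∈ Aᶜ, C i ⊆ ⋃ ab, Y ab := by
    rintro x ⟨hx, hx'⟩
    obtain ⟨a, ha, hxa⟩ := mem_iUnion₂.1 hx
    obtain ⟨b, hb, hxb⟩ := mem_iUnion₂.1 hx'
    exact mem_iUnion.2 ⟨⟨(a, b), ha, hb, x, hxa, hxb⟩, hxa, hxb⟩
  have hnot : ∀ i, ¬ C i ⊆ ⋃ ab, Y ab := fun i =>
    not_subset_iUnion_of_homeomorph_orthant (hhomeo i).some (fun ab => (hY ab).mono d.le_succ) hYc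
  have hjP : C j ⊆ ⋃ i ∈ A, C i := subset_biUnion_of_mem (show j ∈ A from .refl)
  have hkQ : C k ⊆ ⋃ i ∈ Aᶜ, C i := subset_biUnion_of_mem (show k ∈ Aᶜ from hjk)
  rcases subset_or_subset_of_inter_subset_iUnion
    (A.toFinite.isClosed_biUnion fun i _ => hclosed i)
    (Aᶜ.toFinite.isClosed_biUnion fun i _ => hclosed i)
    (by rw [← biUnion_union, union_compl_self, biUnion_univ, hcover]) hY hYc hsub with h | h
  · exact hnot j fun x hx => hsub ⟨hjP hx, h (hjP hx)⟩
  · exact hnot k fun x hx => hsub ⟨h (hkQ hx), hkQ hx⟩
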